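/- Let q = 2 and let ω ∈ Ω̂ be an r-factorable sequence such that each complete factor contains three letters whose kernels cover G_B. Then the growth function of the spinal group G_ω satisfies γ_ω(n) ≾ e^{n^α}, where α = log(q^r)/(log(q^r) − log(2/3)). -/

import Mathlib

noncomputable section

open Equiv

namespace Spinal

/-- The letter `q` of the alphabet `{1,…,q}` (here `q = m + 2`). -/
def qtop (m : ℕ) : Fin (m + 2) := Fin.last (m + 1)

/-- The letter `1` of the alphabet. -/
def qone (m : ℕ) : Fin (m + 2) := 0


theorem qone_ne_qtop (m : ℕ) : qone m ≠ qtop m := by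
  simp [qone, qtop, Fin.ext_iff]

/-- The action of an alphabet permutation on the first letter of a word. -/
def rootFun (m : ℕ) (a : Equiv.Perm (Fin (m + 2))) :
    List (Fin (m + 2)) → List (Fin (m + 2))
  | [] => []
  | y :: w => a y :: w

theorem rootFun_leftInv (m : ℕ) (a : Equiv.Perm (Fin (m + 2))) (w : List (Fin (m + 2))) :
    rootFun m a.symm (rootFun m a w) = w := by
  cases w <;> simp [rootFun]

/-- The tree automorphism induced by a root permutation. -/
def rootAut (m : ℕ) (a : Equiv.Perm (Fin (m + 2))) : Equiv.Perm (List (Fin (m + 2))) where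
  toFun := rootFun m a
  invFun := rootFun m a.symm
  left_inv w := rootFun_leftInv m a w
  right_inv w := by simpa using rootFun_leftInv m a.symm w

variable {GB : Type*} [Group GB]

/-- The spinal action of `b : G_B` determined by the sequence `ω` of homomorphisms:
at the vertex `q^n 1` the next letter is moved by `ω n b` (0-indexed, so `ω 0` is the
paper's `ω₁`). -/
def spinalFun (m : ℕ) (ω : ℕ → GB →* Equiv.Perm (Fin (m + 2))) (b : GB) :
    ℕ → List (Fin (m + 2)) → List (Fin (m + 2))
  | _, [] => []
  | n, y :: w =>
    if y = qtop m then y :: spinalFun m ω b (n + 1) w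
    else if y = qone m then
      y :: (match w with
            | [] => []
            | z :: w' => ω n b z :: w')
    else y :: w

theorem spinalFun_leftInv (m : ℕ) (ω : ℕ → GB →* Equiv.Perm (Fin (m + 2)))
    (b : GB) (n : ℕ) (w : List (Fin (m + 2))) :
    spinalFun m ω b⁻¹ n (spinalFun m ω b n w) = w := by
  induction w generalizing n with
  | nil => simp [spinalFun]
  | cons y w ih =>
    by_cases h1 : y = qtop m
    · simp [spinalFun, h1, ih]
    · by_cases h2 : y = qone m
      · match w with
        | [] => simp [spinalFun, h1, h2]
        | z :: w' => simp [spinalFun, h1, h2, map_inv, qone_ne_qtop]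
      · simp [spinalFun, h1, h2]

/-- The tree automorphism induced by `b : G_B` via the sequence `ω`. -/
def spinalAut (m : ℕ) (ω : ℕ → GB →* Equiv.Perm (Fin (m + 2))) (b : GB) :
    Equiv.Perm (List (Fin (m + 2))) where
  toFun := spinalFun m ω b 0
  invFun := spinalFun m ω b⁻¹ 0
  left_inv w := spinalFun_leftInv m ω b 0 w
  right_inv w := by simpa using spinalFun_leftInv m ω b⁻¹ 0 w

/-- The canonical generating set `S_ω = A ∪ B_ω` (non-identity induced automorphisms). -/
def genSet (m : ℕ) (GA : Subgroup (Equiv.Perm (Fin (m + 2))))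
    (ω : ℕ → GB →* Equiv.Perm (Fin (m + 2))) : Set (Equiv.Perm (List (Fin (m + 2)))) :=
  ((rootAut m '' (GA : Set (Equiv.Perm (Fin (m + 2))))) ∪
    Set.range fun b : GB => spinalAut m ω b) \ {1}

/-- The spinal group `G_ω`, as a subgroup of the permutation group of the vertex set
of the `(m+2)`-regular rooted tree. -/
def spinalGroup (m : ℕ) (GA : Subgroup (Equiv.Perm (Fin (m + 2))))
    (ω : ℕ → GB →* Equiv.Perm (Fin (m + 2))) : Subgroup (Equiv.Perm (List (Fin (m + 2)))) :=
  Subgroup.closure (genSet m GA ω)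

/-- The defining conditions on the data `(G_A, G_B, ω)` of a spinal group:
`G_A` is a transitive (hence faithful) group of permutations of the alphabet,
every `ω n` is an epimorphism onto `G_A`, and `ω ∈ Ω̂`: from every index on, the kernels
of the remaining homomorphisms cover `G_B` and intersect trivially. -/
structure SpinalData (m : ℕ) (GA : Subgroup (Equiv.Perm (Fin (m + 2))))
    (ω : ℕ → GB →* Equiv.Perm (Fin (m + 2))) : Prop where
  transitive : ∀ i j : Fin (m + 2), ∃ a ∈ GA, a i = j
  range_eq : ∀ n, (ω n).range = GA
  kernels_cover : ∀ i : ℕ, ∀ b : GB, ∃ j, i ≤ j ∧ ω j b = 1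
  kernels_sep : ∀ i : ℕ, ∀ b : GB, (∀ j, i ≤ j → ω j b = 1) → b = 1

/-- Word length of a group element with respect to a set of generators. -/
def wordLength {G : Type*} [Group G] (S : Set G) (g : G) : ℕ :=
  sInf {n | ∃ l : List G, l.length = n ∧ (∀ x ∈ l, x ∈ S) ∧ l.prod = g}

/-- The word growth function `γ_ω` of the spinal group with respect to `S_ω`. -/
def growth (m : ℕ) (GA : Subgroup (Equiv.Perm (Fin (m + 2))))
    (ω : ℕ → GB →* Equiv.Perm (Fin (m + 2))) (n : ℕ) : ℕ :=
  Nat.card {g : Equiv.Perm (List (Fin (m + 2))) //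
    g ∈ spinalGroup m GA ω ∧ wordLength (genSet m GA ω) g ≤ n}

/-- The period growth function `π_ω`: the largest order of an element of word length
at most `n`. -/
def periodGrowth (m : ℕ) (GA : Subgroup (Equiv.Perm (Fin (m + 2))))
    (ω : ℕ → GB →* Equiv.Perm (Fin (m + 2))) (n : ℕ) : ℕ :=
  sSup (orderOf '' {g : Equiv.Perm (List (Fin (m + 2))) |
    g ∈ spinalGroup m GA ω ∧ wordLength (genSet m GA ω) g ≤ n})

/-- Abstract letters for words over `S_ω`: an `A`-letter is (induced by) a permutation
of the alphabet, a `B`-letter is (induced by) an element of `G_B`. -/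
abbrev Letter (m : ℕ) (GB : Type*) := Equiv.Perm (Fin (m + 2)) ⊕ GB

/-- Evaluation of an abstract letter as a tree automorphism. -/
def evalLetter (m : ℕ) (ω : ℕ → GB →* Equiv.Perm (Fin (m + 2))) :
    Letter m GB → Equiv.Perm (List (Fin (m + 2))) :=
  Sum.elim (rootAut m) (spinalAut m ω)

/-- The list of `A`-letters of a word, in order. -/
def aLetters {m : ℕ} {GB : Type*} : List (Letter m GB) → List (Equiv.Perm (Fin (m + 2))) :=
  List.filterMap fun x => match x with
    | Sum.inl a => some a
    | Sum.inr _ => none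

/-- The list of `B`-letters of a word, in order. -/
def bLetters {m : ℕ} {GB : Type*} : List (Letter m GB) → List GB :=
  List.filterMap fun x => match x with
    | Sum.inl _ => none
    | Sum.inr b => some b

/-- A word is reduced if its letters alternate between `A`-letters and `B`-letters and
no letter is the identity. -/
def IsReduced {m : ℕ} (F : List (Letter m GB)) : Prop :=
  List.Chain' (fun x y => x.isLeft ≠ y.isLeft) F ∧
    Sum.inl (1 : Equiv.Perm (Fin (m + 2))) ∉ F ∧ Sum.inr (1 : GB) ∉ F

open scoped Classical in
/-- One step of the (complete, confluent) simple reduction process: prepend a letter to an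
already reduced word and reduce. -/
def reduceStep {m : ℕ} : Letter m GB → List (Letter m GB) → List (Letter m GB)
  | Sum.inl a, [] => if a = 1 then [] else [Sum.inl a]
  | Sum.inr b, [] => if b = 1 then [] else [Sum.inr b]
  | Sum.inl a, Sum.inl a' :: t => if a * a' = 1 then t else Sum.inl (a * a') :: t
  | Sum.inr b, Sum.inr b' :: t => if b * b' = 1 then t else Sum.inr (b * b') :: t
  | Sum.inl a, y :: t => if a = 1 then y :: t else Sum.inl a :: y :: t
  | Sum.inr b, y :: t => if b = 1 then y :: t else Sum.inr b :: y :: t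

/-- The reduced form of a word, obtained by simple reductions. -/
def reduceWord {m : ℕ} (F : List (Letter m GB)) : List (Letter m GB) :=
  F.foldr reduceStep []

open scoped Classical in
/-- The (unreduced) projection of a word, representing an element of the first-level
stabilizer, to the coordinate `i` of the first level: scanning the word from the left
while accumulating the product `g` of the `A`-letters, a `B`-letter `b` contributes the
letter `b` at the coordinate `g(q)` and the letter `ω₁(b)` at the coordinate `g(1)`. -/
def projWord (m : ℕ) (ω0 : GB →* Equiv.Perm (Fin (m + 2))) (i : Fin (m + 2)) :
    List (Letter m GB) → Equiv.Perm (Fin (m + 2)) → List (Letter m GB)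
  | [], _ => []
  | Sum.inl a :: F, g => projWord m ω0 i F (g * a)
  | Sum.inr b :: F, g =>
      ((if g (qtop m) = i then [Sum.inr b] else []) ++
        (if g (qone m) = i then [Sum.inl (ω0 b)] else [])) ++ projWord m ω0 i F g

/-- The list of the `q^r` (reduced) words at level `r` of the depth-`r` decomposition
of a word. -/
def levelWords (m : ℕ) :
    (ℕ → GB →* Equiv.Perm (Fin (m + 2))) → ℕ → List (Letter m GB) →
      List (List (Letter m GB))
  | _, 0, F => [F]
  | ω, r + 1, F =>
      (List.finRange (m + 2)).flatMap fun i =>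
        levelWords m (fun n => ω (n + 1)) r (reduceWord (projWord m (ω 0) i F 1))

/-- `|L_r(F)|`: the total length of level `r` of the depth-`r` decomposition of `F`. -/
def levelLength (m : ℕ) (ω : ℕ → GB →* Equiv.Perm (Fin (m + 2))) (r : ℕ)
    (F : List (Letter m GB)) : ℕ :=
  ((levelWords m ω r F).map List.length).sum

/-- The triangular weight of a letter: `A`-letters have weight `τ₀ = 1 - η^r`; a
`B`-letter `b` has weight `τ_i = η^r + η^(r-i) - 1` where `i` is the smallest (1-based)
index with `ω_i(b) = 1`. -/
def letterWeight (m : ℕ) (ω : ℕ → GB →* Equiv.Perm (Fin (m + 2))) (η : ℝ) (r : ℕ) :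
    Letter m GB → ℝ
  | Sum.inl _ => 1 - η ^ r
  | Sum.inr b => η ^ r + η ^ (r - (sInf {j | ω j b = 1} + 1)) - 1

/-- The total triangular weight of a word. -/
def wordWeight (m : ℕ) (ω : ℕ → GB →* Equiv.Perm (Fin (m + 2))) (η : ℝ) (r : ℕ)
    (F : List (Letter m GB)) : ℝ :=
  (F.map (letterWeight m ω η r)).sum

/-- The weight `∂^τ(g)` of a group element: the least total weight of a word over `S_ω`
representing it. -/
def elemWeight (m : ℕ) (GA : Subgroup (Equiv.Perm (Fin (m + 2))))
    (ω : ℕ → GB →* Equiv.Perm (Fin (m + 2))) (η : ℝ) (r : ℕ)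
    (g : Equiv.Perm (List (Fin (m + 2)))) : ℝ :=
  sInf {x : ℝ | ∃ F : List (Letter m GB),
    (∀ a : Equiv.Perm (Fin (m + 2)), Sum.inl a ∈ F → a ∈ GA) ∧
    (F.map (evalLetter m ω)).prod = g ∧ wordWeight m ω η r F = x}

theorem rootAut_one (m : ℕ) : rootAut m 1 = 1 := by
  ext1 w
  cases w <;> rfl

theorem rootAut_mul (m : ℕ) (a b : Equiv.Perm (Fin (m + 2))) :
    rootAut m (a * b) = rootAut m a * rootAut m b := by
  ext1 w
  cases w <;> rfl

theorem spinalFun_mul (m : ℕ) (ω : ℕ → GB →* Equiv.Perm (Fin (m + 2))) (b c : GB) (n : ℕ)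
    (w : List (Fin (m + 2))) :
    spinalFun m ω (b * c) n w = spinalFun m ω b n (spinalFun m ω c n w) := by
  induction w generalizing n with
  | nil => simp [spinalFun]
  | cons y w ih =>
    by_cases h1 : y = qtop m
    · simp [spinalFun, h1, ih]
    · by_cases h2 : y = qone m
      · match w with
        | [] => simp [spinalFun, h2]
        | z :: w' => simp [spinalFun, h2, qone_ne_qtop]
      · simp [spinalFun, h1, h2]

theorem spinalAut_mul (m : ℕ) (ω : ℕ → GB →* Equiv.Perm (Fin (m + 2))) (b c : GB) :
    spinalAut m ω (b * c) = spinalAut m ω b * spinalAut m ω c := by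
  ext1 w
  exact spinalFun_mul m ω b c 0 w

theorem spinalAut_one (m : ℕ) (ω : ℕ → GB →* Equiv.Perm (Fin (m + 2))) :
    spinalAut m ω (1 : GB) = 1 := by
  have h := spinalAut_mul m ω (1 : GB) 1
  rw [mul_one] at h
  exact left_eq_mul.mp h

theorem spinalFun_shift (m : ℕ) (ω : ℕ → GB →* Equiv.Perm (Fin (m + 2))) (b : GB) (n : ℕ)
    (w : List (Fin (m + 2))) :
    spinalFun m ω b (n + 1) w = spinalFun m (fun k => ω (k + 1)) b n w := by
  induction w generalizing n with
  | nil => simp [spinalFun]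
  | cons y w ih => simp only [spinalFun, ih]

theorem spinalAut_cons_one (ω : ℕ → GB →* Equiv.Perm (Fin (0 + 2))) (b : GB)
    (w : List (Fin (0 + 2))) :
    spinalAut 0 ω b (1 :: w) = 1 :: spinalAut 0 (fun k => ω (k + 1)) b w := by
  change spinalFun 0 ω b 0 (1 :: w) = 1 :: spinalFun 0 (fun k => ω (k + 1)) b 0 w
  rw [← spinalFun_shift]
  simp [spinalFun, qtop]

theorem spinalAut_cons_zero (ω : ℕ → GB →* Equiv.Perm (Fin (0 + 2))) (b : GB)
    (w : List (Fin (0 + 2))) :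
    spinalAut 0 ω b (0 :: w) = 0 :: rootAut 0 (ω 0 b) w := by
  change spinalFun 0 ω b 0 (0 :: w) = 0 :: rootFun 0 (ω 0 b) w
  cases w <;> simp [spinalFun, qtop, qone, rootFun]

/-- The non-trivial permutation of the binary alphabet. -/
def flip : Equiv.Perm (Fin (0 + 2)) := Equiv.swap 0 1

theorem perm_eq_one_or_flip (σ : Equiv.Perm (Fin (0 + 2))) : σ = 1 ∨ σ = flip := by
  revert σ
  decide

/-- The tree automorphism `b a b₁ a ⋯ a bₖ`, where `a` is the non-trivial root automorphism. -/
def altEval (ω : ℕ → GB →* Equiv.Perm (Fin (0 + 2))) :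
    GB → List GB → Equiv.Perm (List (Fin (0 + 2)))
  | b, [] => spinalAut 0 ω b
  | b, c :: l => spinalAut 0 ω b * (rootAut 0 flip * altEval ω c l)

/-- The weight of `b a b₁ a ⋯ a bₖ` when `a` has weight `wa` and `B`-letters are weighted
by `w`. -/
def altWeight (wa : ℝ) (w : GB → ℝ) : GB → List GB → ℝ
  | b, [] => w b
  | b, c :: l => w b + wa + altWeight wa w c l

theorem spinalAut_mul_altEval (ω : ℕ → GB →* Equiv.Perm (Fin (0 + 2))) (b c : GB) (l : List GB) :
    spinalAut 0 ω b * altEval ω c l = altEval ω (b * c) l := by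
  cases l <;> simp [altEval, spinalAut_mul, mul_assoc]

theorem rootAut_flip_mul_altEval (ω : ℕ → GB →* Equiv.Perm (Fin (0 + 2))) (c : GB)
    (l : List GB) :
    rootAut 0 flip * altEval ω c l = altEval ω 1 (c :: l) := by
  simp [altEval, spinalAut_one]

theorem altEval_nil (ω : ℕ → GB →* Equiv.Perm (Fin (0 + 2))) (b : GB) (l : List GB) :
    altEval ω b l [] = [] := by
  induction l generalizing b with
  | nil => rfl
  | cons c l ih =>
    simp only [altEval, Equiv.Perm.mul_apply, ih]
    rfl

/-- An admissible weight: subadditive on `G_B`, with `A`-letters of weight between `1/3` and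
`3/2`. -/
structure IsWeight (wa : ℝ) (w : GB → ℝ) : Prop where
  one : w 1 = 0
  nonneg : ∀ b, 0 ≤ w b
  mul_le : ∀ b c, w (b * c) ≤ w b + w c
  lower : 1 / 3 ≤ wa
  upper : wa ≤ 3 / 2

theorem altWeight_mul_le {wa : ℝ} {w : GB → ℝ} (hw : IsWeight wa w) (b c : GB) (l : List GB) :
    altWeight wa w (b * c) l ≤ w b + altWeight wa w c l := by
  have := hw.mul_le b c
  cases l <;> simp only [altWeight] <;> linarith

theorem length_le_altWeight {wa : ℝ} {w : GB → ℝ} (hw : IsWeight wa w) (b : GB) (l : List GB) :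
    (l.length : ℝ) / 3 ≤ altWeight wa w b l := by
  induction l generalizing b with
  | nil => simpa [altWeight] using hw.nonneg b
  | cons c l ih =>
    have h1 := ih c
    have h2 := hw.nonneg b
    have h3 := hw.lower
    simp only [altWeight, List.length_cons, Nat.cast_add, Nat.cast_one]
    linarith

open scoped Classical in
/-- One level of the decomposition of an alternating word. The total weight of the two sections
is controlled when passing to the next level. -/
theorem exists_sections (ω : ℕ → GB →* Equiv.Perm (Fin (0 + 2))) {wa wa' ρ : ℝ} {w w' : GB → ℝ}
    (hw' : IsWeight wa' w')
    (hstep : ∀ b, w' b + (if ω 0 b = 1 then 0 else wa') ≤ ρ * (w b + wa)) (b : GB) (l : List GB) :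
    ∃ (σ : Equiv.Perm (Fin (0 + 2))) (β : Fin (0 + 2) → GB) (v : Fin (0 + 2) → List GB),
      (∀ y u, altEval ω b l (y :: u) =
        σ y :: altEval (fun k => ω (k + 1)) (β y) (v y) u) ∧
      altWeight wa' w' (β 0) (v 0) + altWeight wa' w' (β 1) (v 1) ≤
        ρ * (altWeight wa w b l + wa) := by
  have key : ∀ (b c : GB) (l : List GB), ∃ (d : GB) (l' : List GB),
      rootAut 0 (ω 0 b) * altEval (fun k => ω (k + 1)) c l = altEval (fun k => ω (k + 1)) d l' ∧
      altWeight wa' w' d l' = altWeight wa' w' c l + (if ω 0 b = 1 then 0 else wa') := by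
    intro b c l
    by_cases h : ω 0 b = 1
    · exact ⟨c, l, by rw [h, rootAut_one, one_mul], by simp [h]⟩
    · refine ⟨1, c :: l, ?_, ?_⟩
      · rw [(perm_eq_one_or_flip (ω 0 b)).resolve_left h, rootAut_flip_mul_altEval]
      · simp only [altWeight, hw'.one, h, if_false]
        ring
  induction l generalizing b with
  | nil =>
    obtain ⟨d, l', h1, h2⟩ := key b 1 []
    refine ⟨1, ![d, b], ![l', []], ?_, ?_⟩
    · intro y u
      fin_cases y
      · have := congrArg (fun g => g u) h1
        simp only [altEval, spinalAut_one, mul_one] at this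
        simpa [altEval, ← this] using spinalAut_cons_zero ω b u
      · simpa [altEval] using spinalAut_cons_one ω b u
    · have := hstep b
      simp only [altWeight, hw'.one] at h2
      simp only [Matrix.cons_val_zero, Matrix.cons_val_one, h2, altWeight]
      linarith
  | cons c l ih =>
    obtain ⟨σ, β, v, h1, h2⟩ := ih c
    have hs := hstep b
    have hact : ∀ y u, altEval ω b (c :: l) (y :: u) = spinalAut 0 ω b
        (flip (σ y) :: altEval (fun k => ω (k + 1)) (β y) (v y) u) := by
      intro y u
      simp only [altEval, Equiv.Perm.mul_apply, h1]
      rfl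
    rcases perm_eq_one_or_flip σ with rfl | rfl
    · obtain ⟨d, l', h3, h4⟩ := key b (β 1) (v 1)
      refine ⟨flip, ![b * β 0, d], ![v 0, l'], ?_, ?_⟩
      · intro y u
        rw [hact]
        fin_cases y
        · have := spinalAut_cons_one ω b (altEval (fun k => ω (k + 1)) (β 0) (v 0) u)
          simpa [flip, ← spinalAut_mul_altEval] using this
        · have := spinalAut_cons_zero ω b (altEval (fun k => ω (k + 1)) (β 1) (v 1) u)
          simpa [flip, ← h3] using this
      · have := altWeight_mul_le hw' b (β 0) (v 0)
        simp only [Matrix.cons_val_zero, Matrix.cons_val_one, h4, altWeight]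
        linarith
    · obtain ⟨d, l', h3, h4⟩ := key b (β 0) (v 0)
      refine ⟨1, ![d, b * β 1], ![l', v 1], ?_, ?_⟩
      · intro y u
        rw [hact]
        fin_cases y
        · have := spinalAut_cons_zero ω b (altEval (fun k => ω (k + 1)) (β 0) (v 0) u)
          simpa [flip, ← h3] using this
        · have := spinalAut_cons_one ω b (altEval (fun k => ω (k + 1)) (β 1) (v 1) u)
          simpa [flip, ← spinalAut_mul_altEval] using this
      · have := altWeight_mul_le hw' b (β 1) (v 1)
        simp only [Matrix.cons_val_zero, Matrix.cons_val_one, h4, altWeight]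
        linarith

open scoped Classical in
/-- The indicator of the complement of a kernel. -/
def kerCompl (φ : GB →* Equiv.Perm (Fin (0 + 2))) (b : GB) : ℝ := if φ b = 1 then 0 else 1

theorem kerCompl_one (φ : GB →* Equiv.Perm (Fin (0 + 2))) : kerCompl φ 1 = 0 := by
  simp [kerCompl]

theorem kerCompl_nonneg (φ : GB →* Equiv.Perm (Fin (0 + 2))) (b : GB) : 0 ≤ kerCompl φ b := by
  unfold kerCompl
  split_ifs <;> norm_num

theorem kerCompl_le_one (φ : GB →* Equiv.Perm (Fin (0 + 2))) (b : GB) : kerCompl φ b ≤ 1 := by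
  unfold kerCompl
  split_ifs <;> norm_num

theorem kerCompl_mul_le (φ : GB →* Equiv.Perm (Fin (0 + 2))) (b c : GB) :
    kerCompl φ (b * c) ≤ kerCompl φ b + kerCompl φ c := by
  by_cases hb : φ b = 1
  · by_cases hc : φ c = 1 <;> simp [kerCompl, hb, hc]
  · have h1 : kerCompl φ b = 1 := by simp [kerCompl, hb]
    linarith [kerCompl_le_one φ (b * c), kerCompl_nonneg φ c]

/-- The weight of the `A`-letter at level `i` of a factor whose three distinguished levels are
`j₁ < j₂ < j₃`. -/
def blockWa (j₁ j₂ j₃ i : ℕ) : ℝ :=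
  if i ≤ j₁ then 2 / 3 else if i ≤ j₂ then 1 / 3 else if i ≤ j₃ then 1 / 2 else 1

/-- The weight of `B`-letters at level `i` of a factor whose three distinguished levels are
`j₁ < j₂ < j₃`. -/
def blockW (ω : ℕ → GB →* Equiv.Perm (Fin (0 + 2))) (j₁ j₂ j₃ i : ℕ) (b : GB) : ℝ :=
  if i ≤ j₁ then 0 else if i ≤ j₂ then 1 / 3 * (kerCompl (ω j₂) b + kerCompl (ω j₃) b)
    else if i ≤ j₃ then 1 / 2 * kerCompl (ω j₃) b else 0

theorem blockWa_lower (j₁ j₂ j₃ i : ℕ) : 1 / 3 ≤ blockWa j₁ j₂ j₃ i := by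
  unfold blockWa
  split_ifs <;> norm_num

theorem blockWa_upper (j₁ j₂ j₃ i : ℕ) : blockWa j₁ j₂ j₃ i ≤ 1 := by
  unfold blockWa
  split_ifs <;> norm_num

theorem blockW_nonneg (ω : ℕ → GB →* Equiv.Perm (Fin (0 + 2))) (j₁ j₂ j₃ i : ℕ) (b : GB) :
    0 ≤ blockW ω j₁ j₂ j₃ i b := by
  have h2 := kerCompl_nonneg (ω j₂) b
  have h3 := kerCompl_nonneg (ω j₃) b
  unfold blockW
  split_ifs <;> linarith

theorem blockW_mul_le (ω : ℕ → GB →* Equiv.Perm (Fin (0 + 2))) (j₁ j₂ j₃ i : ℕ) (b c : GB) :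
    blockW ω j₁ j₂ j₃ i (b * c) ≤ blockW ω j₁ j₂ j₃ i b + blockW ω j₁ j₂ j₃ i c := by
  have h2 := kerCompl_mul_le (ω j₂) b c
  have h3 := kerCompl_mul_le (ω j₃) b c
  unfold blockW
  split_ifs <;> linarith

theorem blockW_one (ω : ℕ → GB →* Equiv.Perm (Fin (0 + 2))) (j₁ j₂ j₃ i : ℕ) :
    blockW ω j₁ j₂ j₃ i 1 = 0 := by
  simp [blockW, kerCompl_one]

theorem blockW_step (ω : ℕ → GB →* Equiv.Perm (Fin (0 + 2))) {j₁ j₂ j₃ : ℕ} (h₁₂ : j₁ < j₂)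
    (h₂₃ : j₂ < j₃) (hcover : ∀ b : GB, ω j₁ b = 1 ∨ ω j₂ b = 1 ∨ ω j₃ b = 1) (i : ℕ) (b : GB) :
    blockW ω j₁ j₂ j₃ (i + 1) b + kerCompl (ω i) b * blockWa j₁ j₂ j₃ (i + 1) ≤
      blockW ω j₁ j₂ j₃ i b + blockWa j₁ j₂ j₃ i := by
  have hk : kerCompl (ω j₁) b + kerCompl (ω j₂) b + kerCompl (ω j₃) b ≤ 2 := by
    have h1 := kerCompl_le_one (ω j₁) b
    have h2 := kerCompl_le_one (ω j₂) b
    have h3 := kerCompl_le_one (ω j₃) b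
    rcases hcover b with h | h | h
    · have : kerCompl (ω j₁) b = 0 := by simp [kerCompl, h]
      linarith
    · have : kerCompl (ω j₂) b = 0 := by simp [kerCompl, h]
      linarith
    · have : kerCompl (ω j₃) b = 0 := by simp [kerCompl, h]
      linarith
  have h2 := kerCompl_le_one (ω j₂) b
  have h3 := kerCompl_le_one (ω j₃) b
  have h0 := kerCompl_le_one (ω i) b
  by_cases e1 : i = j₁
  · subst e1
    have a1 : ¬ i + 1 ≤ i := by omega
    have a2 : i + 1 ≤ j₂ := h₁₂
    simp only [blockW, blockWa, a1, a2, le_refl, if_true, if_false]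
    linarith
  by_cases e2 : i = j₂
  · subst e2
    have a1 : ¬ i + 1 ≤ j₁ := by omega
    have a2 : ¬ i ≤ j₁ := by omega
    have a3 : ¬ i + 1 ≤ i := by omega
    have a4 : i + 1 ≤ j₃ := h₂₃
    simp only [blockW, blockWa, a1, a2, a3, a4, le_refl, if_true, if_false]
    linarith
  by_cases e3 : i = j₃
  · subst e3
    have a1 : ¬ i + 1 ≤ j₁ := by omega
    have a2 : ¬ i ≤ j₁ := by omega
    have a3 : ¬ i + 1 ≤ j₂ := by omega
    have a4 : ¬ i ≤ j₂ := by omega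
    have a5 : ¬ i + 1 ≤ i := by omega
    simp only [blockW, blockWa, a1, a2, a3, a4, a5, le_refl, if_true, if_false]
    linarith
  have c1 : i + 1 ≤ j₁ ↔ i ≤ j₁ := by omega
  have c2 : i + 1 ≤ j₂ ↔ i ≤ j₂ := by omega
  have c3 : i + 1 ≤ j₃ ↔ i ≤ j₃ := by omega
  have hW : blockW ω j₁ j₂ j₃ (i + 1) b = blockW ω j₁ j₂ j₃ i b := by
    simp only [blockW, c1, c2, c3]
  have hWa : blockWa j₁ j₂ j₃ (i + 1) = blockWa j₁ j₂ j₃ i := by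
    simp only [blockWa, c1, c2, c3]
  rw [hW, hWa]
  nlinarith [blockWa_lower j₁ j₂ j₃ i]

open scoped Classical in
/-- For a factorable sequence there are admissible weights, one for each level, such that the
total weight is contracted by `ρ` (up to a constant) at each level. -/
theorem exists_weights (ω : ℕ → GB →* Equiv.Perm (Fin (0 + 2))) {r : ℕ} {t : ℕ → ℕ}
    (ht0 : t 0 = 0) (ht : StrictMono t) (htr : ∀ i, t (i + 1) ≤ t i + r)
    (hcover : ∀ i : ℕ, ∃ j₁ j₂ j₃ : ℕ, t i ≤ j₁ ∧ j₁ < j₂ ∧ j₂ < j₃ ∧ j₃ < t (i + 1) ∧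
      ∀ b : GB, ω j₁ b = 1 ∨ ω j₂ b = 1 ∨ ω j₃ b = 1)
    {ρ : ℝ} (hρ0 : 0 < ρ) (hρ1 : ρ ≤ 1) (hρr : 2 / 3 ≤ ρ ^ r) :
    ∃ (wa : ℕ → ℝ) (w : ℕ → GB → ℝ), wa 0 = 1 ∧ w 0 = 0 ∧ (∀ i, IsWeight (wa i) (w i)) ∧
      ∀ i b, w (i + 1) b + (if ω i b = 1 then 0 else wa (i + 1)) ≤ ρ * (w i b + wa i) := by
  choose j₁ j₂ j₃ h1 h12 h23 h3 hc using hcover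
  have hpow : ∀ s ≤ r, 2 / 3 ≤ ρ ^ s := fun s hs =>
    hρr.trans (pow_le_pow_of_le_one hρ0.le hρ1 hs)
  set M : ℕ → ℕ := fun i => Nat.findGreatest (fun k => t k ≤ i) i with hM
  have hMle : ∀ i, t (M i) ≤ i := fun i =>
    Nat.findGreatest_spec (P := fun k => t k ≤ i) (Nat.zero_le i) (by simp [ht0])
  have hMlt : ∀ i, i < t (M i + 1) := by
    intro i
    by_contra! h
    have h' : M i + 1 ≤ M i :=
      Nat.le_findGreatest (P := fun k => t k ≤ i) ((ht.id_le _).trans h) h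
    omega
  have hMeq : ∀ i k, t k ≤ i → i < t (k + 1) → M i = k := by
    intro i k h h'
    have a := ht.lt_iff_lt.mp ((hMle i).trans_lt h')
    have b := ht.lt_iff_lt.mp (h.trans_lt (hMlt i))
    omega
  set c : ℕ → ℝ := fun i => 3 / 2 * ρ ^ (i - t (M i)) with hcdef
  have hc1 : ∀ i, 1 ≤ c i := by
    intro i
    have := hpow (i - t (M i)) (by have := hMlt i; have := htr (M i); omega)
    simp only [hcdef]
    linarith
  have hc2 : ∀ i, c i ≤ 3 / 2 := by
    intro i
    have := pow_le_one₀ (n := i - t (M i)) hρ0.le hρ1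
    simp only [hcdef]
    linarith
  have hkc : ∀ i b (x : ℝ), (if ω i b = 1 then 0 else x) = kerCompl (ω i) b * x := by
    intro i b x
    unfold kerCompl
    split_ifs <;> simp
  refine ⟨fun i => c i * blockWa (j₁ (M i)) (j₂ (M i)) (j₃ (M i)) i,
    fun i b => c i * blockW ω (j₁ (M i)) (j₂ (M i)) (j₃ (M i)) i b, ?_, ?_, ?_, ?_⟩
  · simp [hcdef, blockWa]
  · funext b
    simp [blockW]
  · intro i
    have hl := blockWa_lower (j₁ (M i)) (j₂ (M i)) (j₃ (M i)) i
    have hu := blockWa_upper (j₁ (M i)) (j₂ (M i)) (j₃ (M i)) i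
    have := hc1 i
    have := hc2 i
    refine ⟨by simp [blockW_one], fun b => mul_nonneg (by linarith) (blockW_nonneg ..), ?_,
      by nlinarith, by nlinarith⟩
    intro a b
    rw [← mul_add]
    exact mul_le_mul_of_nonneg_left (blockW_mul_le ..) (by linarith)
  · intro i b
    have hs := blockW_step ω (h12 (M i)) (h23 (M i)) (hc (M i)) i b
    beta_reduce
    rw [hkc]
    rcases Nat.lt_or_ge (i + 1) (t (M i + 1)) with h | h
    · have hMM : M (i + 1) = M i := hMeq _ _ ((hMle i).trans (Nat.le_succ i)) h
      have hcc : c (i + 1) = ρ * c i := by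
        simp only [hcdef, hMM]
        rw [Nat.succ_sub (hMle i), pow_succ]
        ring
      have : 0 ≤ ρ * c i := mul_nonneg hρ0.le (by linarith [hc1 i])
      rw [hMM, hcc]
      nlinarith
    · have hi : i + 1 = t (M i + 1) := le_antisymm (hMlt i) h
      have hMM : M (i + 1) = M i + 1 := hMeq _ _ hi.ge (hi ▸ ht (Nat.lt_succ_self _))
      have hcc : c (i + 1) = 3 / 2 := by simp [hcdef, hMM, ← hi]
      have hci : 1 ≤ ρ * c i := by
        have := hpow (i + 1 - t (M i)) (by have := htr (M i); omega)
        rw [Nat.succ_sub (hMle i), pow_succ] at this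
        simp only [hcdef]
        linarith
      have e1 : i + 1 ≤ j₁ (M i + 1) := hi.le.trans (h1 _)
      have e2 : ¬ i + 1 ≤ j₁ (M i) := by have := h12 (M i); have := h23 (M i); have := h3 (M i); omega
      have e3 : ¬ i + 1 ≤ j₂ (M i) := by have := h23 (M i); have := h3 (M i); omega
      have e4 : ¬ i + 1 ≤ j₃ (M i) := by have := h3 (M i); omega
      have g1 : blockW ω (j₁ (M i)) (j₂ (M i)) (j₃ (M i)) (i + 1) b = 0 := by
        simp [blockW, e2, e3, e4]
      have g2 : blockWa (j₁ (M i)) (j₂ (M i)) (j₃ (M i)) (i + 1) = 1 := by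
        simp [blockWa, e2, e3, e4]
      have g3 : blockW ω (j₁ (M i + 1)) (j₂ (M i + 1)) (j₃ (M i + 1)) (i + 1) b = 0 := by
        simp [blockW, e1]
      have g4 : blockWa (j₁ (M i + 1)) (j₂ (M i + 1)) (j₃ (M i + 1)) (i + 1) = 2 / 3 := by
        simp [blockWa, e1]
      rw [g1, g2] at hs
      simp only [hMM, hcc, g3, g4]
      have := kerCompl_nonneg (ω i) b
      nlinarith [mul_le_mul_of_nonneg_right hci (this.trans (by simpa using hs))]

/-- The least weight of an alternating word representing `g`. -/
def minWeight (ω : ℕ → GB →* Equiv.Perm (Fin (0 + 2))) (wa : ℝ) (w : GB → ℝ)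
    (g : Equiv.Perm (List (Fin (0 + 2)))) : ℝ :=
  sInf {x | ∃ b l, altEval ω b l = g ∧ altWeight wa w b l = x}

section MinWeight

variable {ω : ℕ → GB →* Equiv.Perm (Fin (0 + 2))} {wa : ℝ} {w : GB → ℝ}

theorem altWeight_nonneg (hw : IsWeight wa w) (b : GB) (l : List GB) :
    0 ≤ altWeight wa w b l :=
  le_trans (by positivity) (length_le_altWeight hw b l)

theorem minWeight_nonneg (hw : IsWeight wa w) (g : Equiv.Perm (List (Fin (0 + 2)))) :
    0 ≤ minWeight ω wa w g := by
  apply Real.sInf_nonneg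
  rintro x ⟨b, l, -, rfl⟩
  exact altWeight_nonneg hw b l

theorem minWeight_le (hw : IsWeight wa w) (b : GB) (l : List GB) :
    minWeight ω wa w (altEval ω b l) ≤ altWeight wa w b l := by
  refine csInf_le ⟨0, ?_⟩ ⟨b, l, rfl, rfl⟩
  rintro x ⟨b, l, -, rfl⟩
  exact altWeight_nonneg hw b l

theorem exists_altWeight_lt {g : Equiv.Perm (List (Fin (0 + 2)))}
    (hg : ∃ b l, altEval ω b l = g) {x : ℝ} (hx : minWeight ω wa w g < x) :
    ∃ b l, altEval ω b l = g ∧ altWeight wa w b l < x := by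
  obtain ⟨b, l, hbl⟩ := hg
  have hne : {x | ∃ b l, altEval ω b l = g ∧ altWeight wa w b l = x}.Nonempty :=
    ⟨_, b, l, hbl, rfl⟩
  obtain ⟨_, ⟨b, l, h, rfl⟩, hlt⟩ := exists_lt_of_csInf_lt hne hx
  exact ⟨b, l, h, hlt⟩

open scoped Classical in
theorem exists_minWeight_sections {wa' ρ : ℝ} {w' : GB → ℝ} (hw' : IsWeight wa' w')
    (hρ : 0 < ρ)
    (hstep : ∀ b, w' b + (if ω 0 b = 1 then 0 else wa') ≤ ρ * (w b + wa))
    {g : Equiv.Perm (List (Fin (0 + 2)))} (hg : ∃ b l, altEval ω b l = g) :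
    ∃ (σ : Equiv.Perm (Fin (0 + 2))) (s : Fin (0 + 2) → Equiv.Perm (List (Fin (0 + 2)))),
      (∀ y u, g (y :: u) = σ y :: s y u) ∧
      (∀ y, ∃ b l, altEval (fun k => ω (k + 1)) b l = s y) ∧
      minWeight (fun k => ω (k + 1)) wa' w' (s 0) + minWeight (fun k => ω (k + 1)) wa' w' (s 1) ≤
        ρ * (minWeight ω wa w g + wa) := by
  have hg' := hg
  obtain ⟨b, l, rfl⟩ := hg
  obtain ⟨σ, β, v, h1, -⟩ := exists_sections ω hw' hstep b l
  refine ⟨σ, fun y => altEval (fun k => ω (k + 1)) (β y) (v y), h1, fun y => ⟨_, _, rfl⟩, ?_⟩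
  rw [← div_le_iff₀' hρ, ← sub_le_iff_le_add]
  refine le_csInf ⟨_, b, l, rfl, rfl⟩ ?_
  rintro x ⟨b', l', he, rfl⟩
  obtain ⟨σ', β', v', h1', h2'⟩ := exists_sections ω hw' hstep b' l'
  have hs : ∀ y, altEval (fun k => ω (k + 1)) (β y) (v y) =
      altEval (fun k => ω (k + 1)) (β' y) (v' y) := by
    intro y
    ext1 u
    have := (h1 y u).symm.trans ((congrArg (fun g => g (y :: u)) he.symm).trans (h1' y u))
    exact (List.cons.inj this).2
  rw [sub_le_iff_le_add, div_le_iff₀' hρ]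
  simp only [hs]
  linarith [minWeight_le (ω := fun k => ω (k + 1)) hw' (β' 0) (v' 0),
    minWeight_le (ω := fun k => ω (k + 1)) hw' (β' 1) (v' 1)]

theorem exists_length_le (hw : IsWeight wa w) {g : Equiv.Perm (List (Fin (0 + 2)))}
    (hg : ∃ b l, altEval ω b l = g) {x : ℝ} (hx : minWeight ω wa w g ≤ x) :
    ∃ b l, altEval ω b l = g ∧ (l.length : ℝ) ≤ 3 * (x + 1) := by
  obtain ⟨b, l, h, hlt⟩ := exists_altWeight_lt hg (hx.trans_lt (lt_add_one x))
  exact ⟨b, l, h, by linarith [length_le_altWeight hw b l]⟩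

end MinWeight

/-- The number of elements represented by short alternating words is bounded independently of
the sequence `ω`. -/
theorem exists_card_bound (GB : Type*) [Group GB] [Finite GB] (x : ℝ) :
    ∃ K : ℕ, ∀ (ω : ℕ → GB →* Equiv.Perm (Fin (0 + 2)))
      (S : Finset (Equiv.Perm (List (Fin (0 + 2))))),
      (∀ g ∈ S, ∃ b l, altEval ω b l = g ∧ (l.length : ℝ) ≤ x) → S.card ≤ K := by
  classical
  have hfin : {p : GB × List GB | (p.2.length : ℝ) ≤ x}.Finite := by
    refine (Set.finite_univ.prod (List.finite_length_le GB ⌊x⌋₊)).subset ?_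
    rintro ⟨b, l⟩ h
    exact ⟨trivial, Nat.le_floor h⟩
  refine ⟨hfin.toFinset.card, fun ω S hS => ?_⟩
  have : S ⊆ hfin.toFinset.image fun p => altEval ω p.1 p.2 := by
    intro g hg
    obtain ⟨b, l, h, hl⟩ := hS g hg
    exact Finset.mem_image.mpr ⟨(b, l), by simpa using hl, h⟩
  exact (Finset.card_le_card this).trans Finset.card_image_le

theorem perm_eq_of_sections {g h : Equiv.Perm (List (Fin (0 + 2)))} (hg : g [] = []) (hh : h [] = [])
    {σ : Equiv.Perm (Fin (0 + 2))} {s : Fin (0 + 2) → Equiv.Perm (List (Fin (0 + 2)))}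
    (h1 : ∀ y u, g (y :: u) = σ y :: s y u) (h2 : ∀ y u, h (y :: u) = σ y :: s y u) : g = h := by
  ext1 u
  cases u with
  | nil => rw [hg, hh]
  | cons y u => rw [h1, h2]

open scoped Classical in
/-- A Kraft-type inequality for the elements of the groups at all levels. -/
theorem sum_exp_neg_le_one (ω : ℕ → GB →* Equiv.Perm (Fin (0 + 2))) {wa : ℕ → ℝ}
    {w : ℕ → GB → ℝ} (hw : ∀ i, IsWeight (wa i) (w i)) {ρ : ℝ} (hρ : 0 < ρ)
    (hstep : ∀ i b, w (i + 1) b + (if ω i b = 1 then 0 else wa (i + 1)) ≤ ρ * (w i b + wa i))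
    {f : ℝ → ℝ} {N : ℝ} (hN : 0 ≤ N) {K : ℕ}
    (hK : ∀ (ω : ℕ → GB →* Equiv.Perm (Fin (0 + 2)))
      (S : Finset (Equiv.Perm (List (Fin (0 + 2))))),
      (∀ g ∈ S, ∃ b l, altEval ω b l = g ∧ (l.length : ℝ) ≤ 3 * (N + 1)) → S.card ≤ K)
    (hfK : ∀ x, 0 ≤ x → K * Real.exp (-f x) ≤ 1 / 2)
    (hf : ∀ x x₀ x₁, N < x → 0 ≤ x₀ → 0 ≤ x₁ → x₀ + x₁ ≤ ρ * (x + 3 / 2) →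
      f x₀ + f x₁ + Real.log 4 ≤ f x)
    (hcontr : ∀ x, N < x → ρ * (x + 3 / 2) ≤ x - 1) (n : ℕ) :
    ∀ (i : ℕ) (S : Finset (Equiv.Perm (List (Fin (0 + 2))))),
      (∀ g ∈ S, (∃ b l, altEval (fun k => ω (k + i)) b l = g) ∧
        minWeight (fun k => ω (k + i)) (wa i) (w i) g ≤ n) →
      ∑ g ∈ S, Real.exp (-f (minWeight (fun k => ω (k + i)) (wa i) (w i) g)) ≤ 1 := by
  have small : ∀ (i : ℕ) (S : Finset (Equiv.Perm (List (Fin (0 + 2))))),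
      (∀ g ∈ S, (∃ b l, altEval (fun k => ω (k + i)) b l = g) ∧
        minWeight (fun k => ω (k + i)) (wa i) (w i) g ≤ N) →
      ∑ g ∈ S, Real.exp (-f (minWeight (fun k => ω (k + i)) (wa i) (w i) g)) ≤ 1 / 2 := by
    intro i S hS
    have hcard := hK (fun k => ω (k + i)) S fun g hg =>
      exists_length_le (hw i) (hS g hg).1 (hS g hg).2
    rcases S.eq_empty_or_nonempty with rfl | hne
    · simp
    have hKpos : (0 : ℝ) < K := by exact_mod_cast hne.card_pos.trans_le hcard
    calc ∑ g ∈ S, Real.exp (-f (minWeight (fun k => ω (k + i)) (wa i) (w i) g))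
        ≤ ∑ g ∈ S, 1 / 2 / (K : ℝ) := by
          refine Finset.sum_le_sum fun g _ => ?_
          rw [le_div_iff₀' hKpos]
          exact hfK _ (minWeight_nonneg (hw i) g)
      _ = S.card * (1 / 2 / (K : ℝ)) := by simp
      _ ≤ K * (1 / 2 / (K : ℝ)) := by gcongr
      _ = 1 / 2 := by field_simp
  induction n with
  | zero =>
    intro i S hS
    refine (small i S fun g hg => ⟨(hS g hg).1, (hS g hg).2.trans ?_⟩).trans (by norm_num)
    simpa using hN
  | succ n ih =>
    intro i S hS
    set μ := minWeight (fun k => ω (k + i)) (wa i) (w i) with hμ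
    set ν := minWeight (fun k => ω (k + (i + 1))) (wa (i + 1)) (w (i + 1)) with hν
    have hshift : (fun k => (fun k => ω (k + i)) (k + 1)) = fun k => ω (k + (i + 1)) := by
      funext k
      simp only [add_assoc, add_comm 1 i]
    have hsec : ∀ g, ∃ (σ : Equiv.Perm (Fin (0 + 2)))
        (s : Fin (0 + 2) → Equiv.Perm (List (Fin (0 + 2)))), g ∈ S →
        (∀ y u, g (y :: u) = σ y :: s y u) ∧
        (∀ y, ∃ b l, altEval (fun k => ω (k + (i + 1))) b l = s y) ∧
        ν (s 0) + ν (s 1) ≤ ρ * (μ g + 3 / 2) := by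
      intro g
      by_cases hg : g ∈ S
      · obtain ⟨σ, s, h1, h2, h3⟩ := exists_minWeight_sections (ω := fun k => ω (k + i))
          (wa := wa i) (w := w i) (hw (i + 1)) hρ (by simpa using hstep i) (hS g hg).1
        rw [hshift] at h2 h3
        refine ⟨σ, s, fun _ => ⟨h1, h2, h3.trans ?_⟩⟩
        have := (hw i).upper
        gcongr
      · exact ⟨1, fun _ => 1, fun h => absurd h hg⟩
    choose σ s hs using hsec
    set B := S.filter fun g => ¬ μ g ≤ N with hB
    have hBmem : ∀ g ∈ B, g ∈ S ∧ N < μ g := fun g hg => by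
      simpa [hB] using hg
    have hν0 : ∀ g, 0 ≤ ν g := minWeight_nonneg (hw (i + 1))
    have child : ∀ y, ∑ g ∈ B.image (fun g => s g y), Real.exp (-f (ν g)) ≤ 1 := by
      intro y
      refine ih (i + 1) _ fun h hh => ?_
      obtain ⟨g, hg, rfl⟩ := Finset.mem_image.mp hh
      obtain ⟨hgS, hgN⟩ := hBmem g hg
      obtain ⟨-, h2, h3⟩ := hs g hgS
      refine ⟨h2 y, ?_⟩
      have h4 := hcontr _ hgN
      have h5 := (hS g hgS).2
      have h6 := hν0 (s g 0)
      have h7 := hν0 (s g 1)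
      push_cast at h5
      change ν (s g y) ≤ n
      fin_cases y
      · change ν (s g 0) ≤ n
        linarith
      · change ν (s g 1) ≤ n
        linarith
    have big : ∑ g ∈ B, Real.exp (-f (μ g)) ≤ 1 / 2 := by
      set T := (Finset.univ : Finset (Equiv.Perm (Fin (0 + 2)))) ×ˢ
        (B.image (fun g => s g 0) ×ˢ B.image (fun g => s g 1)) with hT
      let F : Equiv.Perm (Fin (0 + 2)) × Equiv.Perm (List (Fin (0 + 2))) ×
          Equiv.Perm (List (Fin (0 + 2))) → ℝ :=
        fun p => 1 / 4 * (Real.exp (-f (ν p.2.1)) * Real.exp (-f (ν p.2.2)))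
      let e : Equiv.Perm (List (Fin (0 + 2))) → Equiv.Perm (Fin (0 + 2)) ×
          Equiv.Perm (List (Fin (0 + 2))) × Equiv.Perm (List (Fin (0 + 2))) :=
        fun g => (σ g, s g 0, s g 1)
      have hinj : Set.InjOn e B := by
        intro g hg h hh heq
        obtain ⟨hgS, -⟩ := hBmem g hg
        obtain ⟨hhS, -⟩ := hBmem h hh
        simp only [e, Prod.mk.injEq] at heq
        obtain ⟨e1, e2, e3⟩ := heq
        have hss : s h = s g := by
          funext y
          fin_cases y
          · exact e2.symm
          · exact e3.symm
        have nil : ∀ g ∈ S, g [] = [] := by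
          intro g hg
          obtain ⟨b, l, rfl⟩ := (hS g hg).1
          exact altEval_nil _ b l
        refine perm_eq_of_sections (nil g hgS) (nil h hhS) (hs g hgS).1 ?_
        rw [e1, ← hss]
        exact (hs h hhS).1
      calc ∑ g ∈ B, Real.exp (-f (μ g)) ≤ ∑ g ∈ B, F (e g) := by
            refine Finset.sum_le_sum fun g hg => ?_
            obtain ⟨hgS, hgN⟩ := hBmem g hg
            have := hf _ _ _ hgN (hν0 (s g 0)) (hν0 (s g 1)) (hs g hgS).2.2
            simp only [F, e]
            rw [← Real.exp_add, one_div, ← Real.exp_log (show (0 : ℝ) < 4 by norm_num),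
              ← Real.exp_neg, ← Real.exp_add, Real.exp_le_exp]
            linarith
        _ = ∑ p ∈ B.image e, F p := (Finset.sum_image hinj).symm
        _ ≤ ∑ p ∈ T, F p := by
            refine Finset.sum_le_sum_of_subset_of_nonneg ?_ fun p _ _ => by positivity
            intro p hp
            obtain ⟨g, hg, rfl⟩ := Finset.mem_image.mp hp
            simp only [hT, e, Finset.mem_product, Finset.mem_univ, true_and]
            exact ⟨Finset.mem_image_of_mem _ hg, Finset.mem_image_of_mem _ hg⟩
        _ = 2 * (1 / 4 * ((∑ g ∈ B.image (fun g => s g 0), Real.exp (-f (ν g))) *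
              ∑ g ∈ B.image (fun g => s g 1), Real.exp (-f (ν g)))) := by
            have hcard : Fintype.card (Equiv.Perm (Fin (0 + 2))) = 2 := by decide
            simp only [hT, F, Finset.sum_product]
            rw [Finset.sum_const, Finset.card_univ, hcard, nsmul_eq_mul, Finset.sum_mul_sum]
            simp only [Finset.mul_sum, Nat.cast_ofNat]
        _ ≤ 2 * (1 / 4 * (1 * 1)) := by
            gcongr
            · exact child 0
            · exact child 1
        _ = 1 / 2 := by norm_num
    rw [← Finset.sum_filter_add_sum_filter_not S (fun g => μ g ≤ N)]
    have := small i (S.filter fun g => μ g ≤ N) fun g hg => by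
      obtain ⟨h1, h2⟩ := Finset.mem_filter.mp hg
      exact ⟨(hS g h1).1, h2⟩
    linarith

theorem exists_altEval_prod (ω : ℕ → GB →* Equiv.Perm (Fin (0 + 2)))
    (GA : Subgroup (Equiv.Perm (Fin (0 + 2)))) (L : List (Equiv.Perm (List (Fin (0 + 2)))))
    (hL : ∀ x ∈ L, x ∈ genSet 0 GA ω) :
    ∃ b l, altEval ω b l = L.prod ∧ l.length ≤ L.length := by
  induction L with
  | nil => exact ⟨1, [], by simp [altEval, spinalAut_one], le_rfl⟩
  | cons x L ih =>
    obtain ⟨b, l, h, hl⟩ := ih fun y hy => hL y (List.mem_cons_of_mem _ hy)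
    rw [List.prod_cons, ← h]
    rcases (hL x List.mem_cons_self).1 with ⟨a, -, rfl⟩ | ⟨c, rfl⟩
    · rcases perm_eq_one_or_flip a with rfl | rfl
      · exact ⟨b, l, by rw [rootAut_one, one_mul], hl.trans (Nat.le_succ _)⟩
      · exact ⟨1, b :: l, (rootAut_flip_mul_altEval ω b l).symm, Nat.succ_le_succ hl⟩
    · exact ⟨c * b, l, (spinalAut_mul_altEval ω c b l).symm, hl.trans (Nat.le_succ _)⟩

theorem inv_mem_genSet (m : ℕ) (ω : ℕ → GB →* Equiv.Perm (Fin (m + 2)))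
    (GA : Subgroup (Equiv.Perm (Fin (m + 2)))) {x : Equiv.Perm (List (Fin (m + 2)))}
    (hx : x⁻¹ ∈ genSet m GA ω) : x ∈ genSet m GA ω := by
  refine ⟨?_, fun h => hx.2 (by rw [Set.mem_singleton_iff.mp h, inv_one]; rfl)⟩
  rcases hx.1 with ⟨a, ha, h⟩ | ⟨c, h⟩
  · refine Or.inl ⟨a⁻¹, inv_mem ha, ?_⟩
    rw [← inv_inv x, ← h, eq_inv_iff_mul_eq_one, ← rootAut_mul, inv_mul_cancel, rootAut_one]
  · refine Or.inr ⟨c⁻¹, ?_⟩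
    beta_reduce at h ⊢
    rw [← inv_inv x, ← h, eq_inv_iff_mul_eq_one, ← spinalAut_mul, inv_mul_cancel, spinalAut_one]

theorem exists_geodesic_word (m : ℕ) (ω : ℕ → GB →* Equiv.Perm (Fin (m + 2)))
    (GA : Subgroup (Equiv.Perm (Fin (m + 2)))) {g : Equiv.Perm (List (Fin (m + 2)))}
    (hg : g ∈ spinalGroup m GA ω) :
    ∃ L : List (Equiv.Perm (List (Fin (m + 2)))), L.length = wordLength (genSet m GA ω) g ∧
      (∀ x ∈ L, x ∈ genSet m GA ω) ∧ L.prod = g := by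
  rw [spinalGroup, ← Subgroup.mem_toSubmonoid, Subgroup.closure_toSubmonoid] at hg
  obtain ⟨L, hL, hprod⟩ := Submonoid.exists_list_of_mem_closure hg
  have hne : {n | ∃ l : List (Equiv.Perm (List (Fin (m + 2)))), l.length = n ∧
      (∀ x ∈ l, x ∈ genSet m GA ω) ∧ l.prod = g}.Nonempty :=
    ⟨_, L, rfl, fun x hx => (hL x hx).elim id (inv_mem_genSet m ω GA), hprod⟩
  exact Nat.sInf_mem hne

theorem exists_altEval_of_mem_spinalGroup (ω : ℕ → GB →* Equiv.Perm (Fin (0 + 2)))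
    (GA : Subgroup (Equiv.Perm (Fin (0 + 2)))) {g : Equiv.Perm (List (Fin (0 + 2)))}
    (hg : g ∈ spinalGroup 0 GA ω) :
    ∃ b l, altEval ω b l = g ∧ l.length ≤ wordLength (genSet 0 GA ω) g := by
  obtain ⟨L', hlen, hL', rfl⟩ := exists_geodesic_word 0 ω GA hg
  obtain ⟨b, l, h, hl⟩ := exists_altEval_prod ω GA L' hL'
  exact ⟨b, l, h, hl.trans hlen.le⟩

theorem growth_zero_le_one (m : ℕ) (ω : ℕ → GB →* Equiv.Perm (Fin (m + 2)))
    (GA : Subgroup (Equiv.Perm (Fin (m + 2)))) : growth m GA ω 0 ≤ 1 := by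
  have : Subsingleton {g : Equiv.Perm (List (Fin (m + 2))) //
      g ∈ spinalGroup m GA ω ∧ wordLength (genSet m GA ω) g ≤ 0} := by
    have key : ∀ g ∈ spinalGroup m GA ω, wordLength (genSet m GA ω) g ≤ 0 → g = 1 := by
      intro g hg h0
      obtain ⟨L', hlen, -, rfl⟩ := exists_geodesic_word m ω GA hg
      have : L' = [] := List.length_eq_zero_iff.mp (hlen.trans (Nat.le_zero.mp h0))
      rw [this, List.prod_nil]
    exact ⟨fun x y => Subtype.ext ((key _ x.2.1 x.2.2).trans (key _ y.2.1 y.2.2).symm)⟩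
  exact Finite.card_le_one_iff_subsingleton.mpr this

theorem add_rpow_le_rpow_add_mul {u e α : ℝ} (hu : 0 < u) (he : 0 ≤ e) (h0 : 0 ≤ α) (h1 : α ≤ 1) :
    (u + e) ^ α ≤ u ^ α + α * e * u ^ (α - 1) := by
  have h : (1 + e / u) ^ α ≤ 1 + α * (e / u) :=
    rpow_one_add_le_one_add_mul_self (by have := div_nonneg he hu.le; linarith) h0 h1
  have e1 : u + e = u * (1 + e / u) := by field_simp
  rw [e1, Real.mul_rpow hu.le (by positivity), Real.rpow_sub_one hu.ne']
  calc u ^ α * (1 + e / u) ^ α ≤ u ^ α * (1 + α * (e / u)) := by gcongr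
    _ = u ^ α + α * e * (u ^ α / u) := by ring

theorem rpow_add_rpow_le {a b α : ℝ} (ha : 0 ≤ a) (hb : 0 ≤ b) (h0 : 0 ≤ α) (h1 : α ≤ 1) :
    a ^ α + b ^ α ≤ 2 ^ (1 - α) * (a + b) ^ α := by
  have h := (Real.concaveOn_rpow h0 h1).2 (x := a) (y := b) ha hb
    (show (0 : ℝ) ≤ 1 / 2 by norm_num) (show (0 : ℝ) ≤ 1 / 2 by norm_num) (by norm_num)
  simp only [smul_eq_mul] at h
  rw [← mul_add, ← mul_add, Real.mul_rpow (by norm_num) (by positivity), one_div,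
    Real.inv_rpow (by norm_num)] at h
  rw [Real.rpow_sub (by norm_num), Real.rpow_one]
  have h2 : (2 : ℝ) / 2 ^ α * (a + b) ^ α = 2 * ((2 ^ α)⁻¹ * (a + b) ^ α) := by ring
  linarith

/-- The function `A ((x + 1)^α - 1/2)` is superadditive enough for the recursion
`x₀ + x₁ ≤ ρ (x + 3/2)` when `2 (ρ / 2)^α = 1`. -/
theorem exists_recursion_threshold {α ρ : ℝ} (h0 : 0 < α) (h1 : α < 1) (hρ0 : 0 < ρ)
    (hρ1 : ρ < 1) (hcrit : (2 : ℝ) ^ (1 - α) * ρ ^ α = 1) :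
    ∃ N : ℝ, 0 ≤ N ∧ (∀ x, N < x → ρ * (x + 3 / 2) ≤ x - 1) ∧
      ∀ A : ℝ, 4 * Real.log 4 ≤ A → ∀ x x₀ x₁ : ℝ, N < x → 0 ≤ x₀ → 0 ≤ x₁ →
        x₀ + x₁ ≤ ρ * (x + 3 / 2) →
        A * ((x₀ + 1) ^ α - 1 / 2) + A * ((x₁ + 1) ^ α - 1 / 2) + Real.log 4 ≤
          A * ((x + 1) ^ α - 1 / 2) := by
  set e : ℝ := 1 / 2 + 2 / ρ with he
  have he0 : 0 ≤ e := by positivity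
  have htend : Filter.Tendsto (fun u : ℝ => α * e * u ^ (α - 1)) Filter.atTop (nhds 0) := by
    have := (tendsto_rpow_neg_atTop (show 0 < 1 - α by linarith)).const_mul (α * e)
    simpa using this
  obtain ⟨N₁, hN₁⟩ := Filter.eventually_atTop.mp
    (htend.eventually_le_const (show (0 : ℝ) < 1 / 4 by norm_num))
  refine ⟨max (max N₁ 0) (5 / (2 * (1 - ρ))), (le_max_right _ _).trans (le_max_left _ _), ?_, ?_⟩
  · intro x hx
    have := (le_max_right _ _).trans_lt hx
    rw [div_lt_iff₀ (by linarith)] at this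
    nlinarith
  · intro A hA x x₀ x₁ hx hx₀ hx₁ hsum
    have hx1 : N₁ < x := ((le_max_left _ _).trans (le_max_left _ _)).trans_lt hx
    have hx0 : 0 < x := ((le_max_right _ _).trans (le_max_left _ _)).trans_lt hx
    have hA0 : 0 ≤ A := le_trans (mul_nonneg (by norm_num) (Real.log_nonneg (by norm_num))) hA
    have key : (x₀ + 1) ^ α + (x₁ + 1) ^ α ≤ (x + 1) ^ α + 1 / 4 := by
      calc (x₀ + 1) ^ α + (x₁ + 1) ^ α
          ≤ 2 ^ (1 - α) * (x₀ + 1 + (x₁ + 1)) ^ α :=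
            rpow_add_rpow_le (by linarith) (by linarith) h0.le h1.le
        _ ≤ 2 ^ (1 - α) * (ρ * (x + 1 + e)) ^ α := by
            gcongr
            have : ρ * (x + 1 + e) = ρ * (x + 3 / 2) + 2 := by
              rw [he]
              field_simp
              ring
            linarith
        _ = (x + 1 + e) ^ α := by
            rw [Real.mul_rpow hρ0.le (by linarith), ← mul_assoc, hcrit, one_mul]
        _ ≤ (x + 1) ^ α + α * e * (x + 1) ^ (α - 1) :=
            add_rpow_le_rpow_add_mul (by linarith) he0 h0.le h1.le
        _ ≤ (x + 1) ^ α + 1 / 4 := by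
            gcongr
            exact hN₁ _ (by linarith)
    nlinarith [mul_le_mul_of_nonneg_left key hA0]

/-- 2/3-Estimate: let `q = 2` and `ω ∈ Ω̂` be `r`-factorable with each factor containing
three letters whose kernels cover `G_B`. Then `γ_ω(n) ≾ e^{n^α}` with
`α = log(q^r) / (log(q^r) − log(2/3))`. -/
theorem spinalGroup_growth_upper_bound_two_thirds (GA : Subgroup (Equiv.Perm (Fin (0 + 2))))
    {GB : Type*} [Group GB] [Finite GB] (ω : ℕ → GB →* Equiv.Perm (Fin (0 + 2)))
    (hdata : SpinalData 0 GA ω) (r : ℕ)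
    (hfact : ∃ t : ℕ → ℕ, t 0 = 0 ∧ StrictMono t ∧ (∀ i, t (i + 1) ≤ t i + r) ∧
      ∀ i : ℕ, ∃ j₁ j₂ j₃ : ℕ, t i ≤ j₁ ∧ j₁ < j₂ ∧ j₂ < j₃ ∧ j₃ < t (i + 1) ∧
        ∀ b : GB, ω j₁ b = 1 ∨ ω j₂ b = 1 ∨ ω j₃ b = 1) :
    ∃ C : ℝ, 0 < C ∧ ∀ n : ℕ,
      (growth 0 GA ω n : ℝ) ≤
        Real.exp ((C * n) ^
          (Real.log ((2 : ℝ) ^ r) / (Real.log ((2 : ℝ) ^ r) - Real.log (2 / 3)))) := by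
  classical
  obtain ⟨t, ht0, ht, htr, hcover⟩ := hfact
  have hr : 0 < r := by
    have h1 := ht Nat.zero_lt_one
    have h2 := htr 0
    rw [zero_add] at h2
    omega
  have hr' : (0 : ℝ) < r := by exact_mod_cast hr
  set α := Real.log ((2 : ℝ) ^ r) / (Real.log ((2 : ℝ) ^ r) - Real.log (2 / 3)) with hα
  have hlog2 : 0 < Real.log 2 := Real.log_pos (by norm_num)
  have hlog23 : Real.log (2 / 3) < 0 := Real.log_neg (by norm_num) (by norm_num)
  rw [Real.log_pow] at hα
  have hden : 0 < r * Real.log 2 - Real.log (2 / 3) := by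
    have := mul_pos hr' hlog2
    linarith
  have hα0 : 0 < α := hα ▸ div_pos (mul_pos hr' hlog2) hden
  have hα1 : α < 1 := by
    rw [hα, div_lt_one hden]
    linarith
  set ρ : ℝ := (2 / 3 : ℝ) ^ ((r : ℝ)⁻¹) with hρ
  have hρ0 : 0 < ρ := by positivity
  have hρ1 : ρ < 1 := Real.rpow_lt_one (by norm_num) (by norm_num) (by positivity)
  have hρr : ρ ^ r = 2 / 3 := Real.rpow_inv_natCast_pow (by norm_num) hr.ne'
  have hcrit : (2 : ℝ) ^ (1 - α) * ρ ^ α = 1 := by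
    rw [hρ, ← Real.rpow_mul (by norm_num), Real.rpow_def_of_pos (by norm_num),
      Real.rpow_def_of_pos (by norm_num), ← Real.exp_add, Real.exp_eq_one_iff]
    have hD := (eq_div_iff hden.ne').mp hα
    have hri := mul_inv_cancel₀ hr'.ne'
    linear_combination -(r : ℝ)⁻¹ * hD - (Real.log 2 - α * Real.log 2) * hri
  obtain ⟨wa, w, hwa0, hw0, hw, hstep⟩ :=
    exists_weights ω ht0 ht htr hcover hρ0 hρ1.le hρr.ge
  obtain ⟨N, hN, hcontr, hrec⟩ := exists_recursion_threshold hα0 hα1 hρ0 hρ1 hcrit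
  obtain ⟨K, hK⟩ := exists_card_bound GB (3 * (N + 1))
  set A : ℝ := max (4 * Real.log 4) (2 * Real.log (2 * K + 1)) with hA
  have hA0 : 0 < A :=
    (mul_pos (by norm_num) (Real.log_pos (by norm_num))).trans_le (le_max_left _ _)
  have hsmall : ∀ x : ℝ, 0 ≤ x → K * Real.exp (-(A * ((x + 1) ^ α - 1 / 2))) ≤ 1 / 2 := by
    intro x hx
    have h1 : 1 ≤ (x + 1) ^ α := Real.one_le_rpow (by linarith) hα0.le
    have h2 : Real.log (2 * K + 1) ≤ A * ((x + 1) ^ α - 1 / 2) := by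
      have : 2 * Real.log (2 * K + 1) ≤ A := le_max_right _ _
      nlinarith
    have hpos : (0 : ℝ) < 2 * K + 1 := by positivity
    calc K * Real.exp (-(A * ((x + 1) ^ α - 1 / 2)))
        ≤ K * Real.exp (-Real.log (2 * K + 1)) := by gcongr
      _ = K * (2 * K + 1 : ℝ)⁻¹ := by rw [Real.exp_neg, Real.exp_log hpos]
      _ ≤ 1 / 2 := by
        rw [← div_eq_mul_inv, div_le_iff₀ hpos]
        linarith
  have hkraft := sum_exp_neg_le_one ω hw hρ0 hstep (f := fun x => A * ((x + 1) ^ α - 1 / 2))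
    hN hK hsmall (hrec A (le_max_left _ _)) hcontr
  refine ⟨2 * A ^ α⁻¹, by positivity, fun n => ?_⟩
  rcases Nat.eq_zero_or_pos n with rfl | hn
  · have : (growth 0 GA ω 0 : ℝ) ≤ 1 := by exact_mod_cast growth_zero_le_one 0 ω GA
    simpa [Real.zero_rpow hα0.ne'] using this
  have hminw : ∀ g ∈ spinalGroup 0 GA ω, wordLength (genSet 0 GA ω) g ≤ n →
      (∃ b l, altEval (fun k => ω (k + 0)) b l = g) ∧
        minWeight (fun k => ω (k + 0)) (wa 0) (w 0) g ≤ n := by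
    intro g hg hgn
    obtain ⟨b, l, rfl, hl⟩ := exists_altEval_of_mem_spinalGroup ω GA hg
    refine ⟨⟨b, l, rfl⟩, (minWeight_le (hw 0) b l).trans ?_⟩
    have hlen : ∀ (b : GB) (l : List GB), altWeight (wa 0) (w 0) b l = l.length := by
      intro b l
      induction l generalizing b with
      | nil => simp [altWeight, hw0]
      | cons c l ih =>
        rw [altWeight, ih, hwa0, hw0, Pi.zero_apply, List.length_cons]
        push_cast
        ring
    rw [hlen]
    exact_mod_cast hl.trans hgn
  rcases Set.finite_or_infinite {g : Equiv.Perm (List (Fin (0 + 2))) |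
      g ∈ spinalGroup 0 GA ω ∧ wordLength (genSet 0 GA ω) g ≤ n} with hfin | hinf
  swap
  · have : growth 0 GA ω n = 0 := by
      have := Set.infinite_coe_iff.mpr hinf
      exact @Nat.card_eq_zero_of_infinite _ this
    rw [this, Nat.cast_zero]
    exact (Real.exp_pos _).le
  have hgrowth : growth 0 GA ω n = hfin.toFinset.card := Nat.card_eq_card_finite_toFinset hfin
  have hsum := hkraft n 0 hfin.toFinset fun g hg => by
    have := hfin.mem_toFinset.mp hg
    exact hminw g this.1 this.2
  have hle : (hfin.toFinset.card : ℝ) * Real.exp (-(A * ((n + 1 : ℝ) ^ α - 1 / 2))) ≤ 1 := by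
    rw [← nsmul_eq_mul]
    refine (Finset.card_nsmul_le_sum _ _ _ fun g hg => ?_).trans hsum
    have hg' := hfin.mem_toFinset.mp hg
    have h1 := (hminw g hg'.1 hg'.2).2
    have h2 := minWeight_nonneg (ω := fun k => ω (k + 0)) (hw 0) g
    gcongr
  rw [Real.exp_neg, ← div_eq_mul_inv, div_le_one (Real.exp_pos _)] at hle
  rw [hgrowth]
  refine hle.trans (Real.exp_le_exp.mpr ?_)
  have hn1 : (1 : ℝ) ≤ n := by exact_mod_cast hn
  calc A * ((n + 1 : ℝ) ^ α - 1 / 2) ≤ A * (2 * n : ℝ) ^ α := by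
        gcongr
        have : (n + 1 : ℝ) ^ α ≤ (2 * n : ℝ) ^ α := by
          gcongr
          linarith
        linarith
    _ = (2 * A ^ α⁻¹ * n) ^ α := by
        rw [mul_right_comm 2, Real.mul_rpow (x := 2 * (n : ℝ)) (by positivity) (by positivity),
          Real.rpow_inv_rpow hA0.le hα0.ne', mul_comm]
end Spinal
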